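/- Let G be a finitely generated group and μ a courteous probability measure on G. If dim HF_k(G,μ) < ∞ for some k ≥ 0, then G is amenable: for every finite subset K ⊆ G and every ε > 0 there exists a finite subset F ⊆ G with |KF| ≤ (1+ε)|F|. -/

import Mathlib

open scoped ENNReal Pointwise

/-- The word length of `x` with respect to a generating set `S`:
the least `n` such that `x` is a product of `n` elements of `S`. -/
noncomputable def wordLen {G : Type*} [Group G] (S : Set G) (x : G) : ℕ :=
  sInf {n : ℕ | ∃ l : List G, (∀ s ∈ l, s ∈ S) ∧ l.length = n ∧ l.prod = x}

/-- `f : G → ℂ` is `μ`-harmonic: `f x = ∑ₛ μ(s) f(x s⁻¹)`. -/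
def IsHarmonic {G : Type*} [Group G] (μ : G → ℝ) (f : G → ℂ) : Prop :=
  ∀ x : G, f x = ∑' s : G, (μ s : ℂ) * f (x * s⁻¹)

/-- The polynomial-`k`-seminorm `‖f‖ₖ = limsup_{r → ∞} r^{-k} · max_{|x| ≤ r} |f(x)|`,
valued in `ℝ≥0∞`. -/
noncomputable def polyNorm {G : Type*} [Group G] (S : Set G) (k : ℕ) (f : G → ℂ) : ℝ≥0∞ :=
  Filter.limsup
    (fun r : ℕ => ((r : ℝ≥0∞) ^ k)⁻¹ * ⨆ (x : G) (_ : wordLen S x ≤ r), (‖f x‖₊ : ℝ≥0∞))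
    Filter.atTop

/-- `HFk S μ k` : the set of `μ`-harmonic functions of polynomial growth of degree at most `k`. -/
noncomputable def HFk {G : Type*} [Group G] (S : Set G) (μ : G → ℝ) (k : ℕ) : Set (G → ℂ) :=
  {f | IsHarmonic μ f ∧ polyNorm S k f < ⊤}

section Liouville

variable {G : Type*} [Group G] {μ : G → ℝ}

lemma summable_mul_of_bounded (hnonneg : ∀ x, 0 ≤ μ x) (hμ : Summable μ) {f : G → ℂ} {C : ℝ}
    (hf : ∀ x, ‖f x‖ ≤ C) (x : G) : Summable fun s => (μ s : ℂ) * f (x * s⁻¹) := by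
  refine Summable.of_norm_bounded (hμ.mul_right C) fun s => ?_
  rw [norm_mul, Complex.norm_real, Real.norm_of_nonneg (hnonneg s)]
  exact mul_le_mul_of_nonneg_left (hf _) (hnonneg s)

/-- The space of bounded `μ`-harmonic functions. -/
def boundedHarmonic (hnonneg : ∀ x, 0 ≤ μ x) (hμ : Summable μ) : Submodule ℂ (G → ℂ) where
  carrier := {f | IsHarmonic μ f ∧ ∃ C : ℝ, ∀ x, ‖f x‖ ≤ C}
  zero_mem' := ⟨fun x => by simp, 0, by simp⟩
  add_mem' := by
    rintro f g ⟨hf, C, hC⟩ ⟨hg, D, hD⟩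
    refine ⟨fun x => ?_, C + D, fun x => (norm_add_le _ _).trans (add_le_add (hC x) (hD x))⟩
    simp only [Pi.add_apply, mul_add]
    rw [(summable_mul_of_bounded hnonneg hμ hC x).tsum_add
      (summable_mul_of_bounded hnonneg hμ hD x), ← hf x, ← hg x]
  smul_mem' := by
    rintro c f ⟨hf, C, hC⟩
    refine ⟨fun x => ?_, ‖c‖ * C, fun x => ?_⟩
    · simp only [Pi.smul_apply, smul_eq_mul, mul_left_comm _ c]
      rw [tsum_mul_left, ← hf x]
    · rw [Pi.smul_apply, norm_smul]
      exact mul_le_mul_of_nonneg_left (hC x) (norm_nonneg c)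

lemma translate_mem_boundedHarmonic (hnonneg : ∀ x, 0 ≤ μ x) (hμ : Summable μ) {f : G → ℂ}
    (hf : f ∈ boundedHarmonic hnonneg hμ) (g : G) :
    (fun y => f (g * y)) ∈ boundedHarmonic hnonneg hμ := by
  obtain ⟨hf, C, hC⟩ := hf
  exact ⟨fun x => by simpa only [mul_assoc] using hf (g * x), C, fun x => hC _⟩

/-- Bounded harmonic functions have finite polynomial seminorm of every degree. -/
lemma mem_HFk_of_bounded (S : Set G) (k : ℕ) {f : G → ℂ} (hf : IsHarmonic μ f) {C : ℝ}
    (hC : ∀ x, ‖f x‖ ≤ C) : f ∈ HFk S μ k := by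
  refine ⟨hf, lt_of_le_of_lt (b := ENNReal.ofReal C) ?_ ENNReal.ofReal_lt_top⟩
  refine Filter.limsup_le_of_le (by isBoundedDefault) ?_
  filter_upwards [Filter.eventually_ge_atTop 1] with r hr
  have h1 : ((r : ℝ≥0∞) ^ k)⁻¹ ≤ 1 :=
    ENNReal.inv_le_one.2 (one_le_pow₀ (by exact_mod_cast hr))
  calc _ ≤ 1 * ENNReal.ofReal C := by
        refine mul_le_mul' h1 (iSup₂_le fun x _ => ?_)
        exact (ofReal_norm (f x)).symm.trans_le (ENNReal.ofReal_le_ofReal (hC x))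
    _ = _ := one_mul _

/-- The variance of one step of the random walk, evaluated along a bounded harmonic function. -/
lemma hasSum_variance (hnonneg : ∀ x, 0 ≤ μ x) (hprob : HasSum μ 1) {f : G → ℂ}
    (hf : IsHarmonic μ f) {C : ℝ} (hC : ∀ x, ‖f x‖ ≤ C) (x : G) :
    HasSum (fun s => μ s * ‖f (x * s⁻¹) - f x‖ ^ 2)
      ((∑' s, μ s * ‖f (x * s⁻¹)‖ ^ 2) - ‖f x‖ ^ 2) := by
  have h1 : HasSum (fun s => (μ s : ℂ) * f (x * s⁻¹)) (f x) := by
    have := (summable_mul_of_bounded hnonneg hprob.summable hC x).hasSum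
    rwa [← hf x] at this
  have h2 := Complex.hasSum_re (h1.mul_right (starRingEnd ℂ (f x)))
  have h3 : HasSum (fun s => μ s * ‖f (x * s⁻¹)‖ ^ 2) (∑' s, μ s * ‖f (x * s⁻¹)‖ ^ 2) := by
    refine Summable.hasSum (Summable.of_nonneg_of_le
      (fun s => mul_nonneg (hnonneg s) (sq_nonneg _)) (fun s => ?_)
      (hprob.summable.mul_right (C ^ 2)))
    exact mul_le_mul_of_nonneg_left (pow_le_pow_left₀ (norm_nonneg _) (hC _) 2) (hnonneg s)
  have h4 := hprob.mul_right (‖f x‖ ^ 2)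
  have h5 := (h3.add h4).sub (h2.mul_left 2)
  have h6 : (∑' s, μ s * ‖f (x * s⁻¹)‖ ^ 2) + 1 * ‖f x‖ ^ 2 -
      2 * (f x * starRingEnd ℂ (f x)).re = (∑' s, μ s * ‖f (x * s⁻¹)‖ ^ 2) - ‖f x‖ ^ 2 := by
    rw [Complex.mul_conj, Complex.ofReal_re, ← Complex.sq_norm]
    ring
  rw [h6] at h5
  refine h5.congr_fun fun s => ?_
  simp only [Complex.sq_norm, Complex.normSq_sub, mul_assoc, Complex.re_ofReal_mul]
  ring

/-- A finite family of bounded harmonic functions is almost invariant under a given step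
of the random walk at some point. -/
lemma exists_forall_norm_sub_lt (hnonneg : ∀ x, 0 ≤ μ x) (hprob : HasSum μ 1) {ι : Type*}
    [Fintype ι] {f : ι → G → ℂ} (hf : ∀ i, f i ∈ boundedHarmonic hnonneg hprob.summable)
    {s : G} (hs : μ s ≠ 0) {ε : ℝ} (hε : 0 < ε) :
    ∃ x, ∀ i, ‖f i (x * s⁻¹) - f i x‖ < ε := by
  choose hharm C hC using hf
  set q : G → ℝ := fun x => ∑ i, ‖f i x‖ ^ 2 with hq
  have hqle : ∀ x, q x ≤ ∑ i, C i ^ 2 := fun x =>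
    Finset.sum_le_sum fun i _ => pow_le_pow_left₀ (norm_nonneg _) (hC i x) 2
  have hbdd : BddAbove (Set.range q) := ⟨_, by rintro _ ⟨x, rfl⟩; exact hqle x⟩
  have hs0 : 0 < μ s := lt_of_le_of_ne (hnonneg s) (Ne.symm hs)
  obtain ⟨x, hx⟩ := exists_lt_of_lt_ciSup
    (show (⨆ x, q x) - μ s * ε ^ 2 < ⨆ x, q x by have := mul_pos hs0 (pow_pos hε 2); linarith)
  refine ⟨x, fun i => ?_⟩
  have hv := fun i => hasSum_variance hnonneg hprob (hharm i) (hC i) x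
  have hsum : Summable fun t => μ t * q (x * t⁻¹) := by
    refine Summable.of_nonneg_of_le (fun t => mul_nonneg (hnonneg t) (by positivity)) (fun t => ?_)
      (hprob.summable.mul_right (∑ i, C i ^ 2))
    exact mul_le_mul_of_nonneg_left (hqle _) (hnonneg t)
  have hle : ∑' t, μ t * q (x * t⁻¹) ≤ ⨆ x, q x := by
    have h := hprob.mul_right (⨆ x, q x)
    rw [one_mul] at h
    exact hasSum_le (fun t => mul_le_mul_of_nonneg_left (le_ciSup hbdd _) (hnonneg t))
      hsum.hasSum h
  have hsplit : ∑' t, μ t * q (x * t⁻¹) = ∑ i, ∑' t, μ t * ‖f i (x * t⁻¹)‖ ^ 2 := by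
    simp only [hq, Finset.mul_sum]
    refine Summable.tsum_finsetSum fun i _ => Summable.of_nonneg_of_le
      (fun t => mul_nonneg (hnonneg t) (sq_nonneg _)) (fun t => ?_)
      (hprob.summable.mul_right (C i ^ 2))
    exact mul_le_mul_of_nonneg_left (pow_le_pow_left₀ (norm_nonneg _) (hC i _) 2) (hnonneg t)
  have hterm : ∀ i, μ s * ‖f i (x * s⁻¹) - f i x‖ ^ 2 ≤
      (∑' t, μ t * ‖f i (x * t⁻¹)‖ ^ 2) - ‖f i x‖ ^ 2 := fun i =>
    le_hasSum (hv i) s fun t _ => mul_nonneg (hnonneg t) (sq_nonneg _)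
  have htotal : μ s * ‖f i (x * s⁻¹) - f i x‖ ^ 2 ≤ (∑' t, μ t * q (x * t⁻¹)) - q x := by
    rw [hsplit, hq, ← Finset.sum_sub_distrib]
    refine (hterm i).trans (Finset.single_le_sum (f := fun i =>
      (∑' t, μ t * ‖f i (x * t⁻¹)‖ ^ 2) - ‖f i x‖ ^ 2) (fun j _ => ?_) (Finset.mem_univ i))
    exact (mul_nonneg (hnonneg s) (sq_nonneg _)).trans (hterm j)
  exact lt_of_pow_lt_pow_left₀ 2 hε.le (lt_of_mul_lt_mul_left (by linarith) hs0.le)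

/-- In a finite-dimensional space of functions, the coordinates of uniformly bounded functions
are uniformly bounded. -/
lemma exists_bound_repr {X ι : Type*} [Fintype ι] {V : Submodule ℂ (X → ℂ)}
    (b : Module.Basis ι ℂ V) (C : ℝ) :
    ∃ D : ℝ, ∀ v : V, (∀ x, ‖(v : X → ℂ) x‖ ≤ C) → ∀ i, ‖b.repr v i‖ ≤ D := by
  have : FiniteDimensional ℂ V := b.finiteDimensional_of_finite
  have hcomp : IsCompact {v : V | ∀ x, ‖(v : X → ℂ) x‖ ≤ C} := by
    have h1 : IsCompact {f : X → ℂ | ∀ x, f x ∈ Metric.closedBall (0 : ℂ) C} :=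
      isCompact_pi_infinite fun _ => isCompact_closedBall 0 C
    have h2 :=
      (Submodule.closed_of_finiteDimensional V).isClosedEmbedding_subtypeVal.isCompact_preimage h1
    simpa [Set.preimage, mem_closedBall_zero_iff] using h2
  have hcont : Continuous fun v : V => b.equivFun v :=
    LinearMap.continuous_of_finiteDimensional (b.equivFun : V →ₗ[ℂ] ι → ℂ)
  obtain ⟨D, hD⟩ := (hcomp.image hcont).isBounded.exists_norm_le
  exact ⟨D, fun v hv i => (norm_le_pi_norm (b.equivFun v) i).trans (hD _ ⟨v, hv, rfl⟩)⟩

/-- If the space of bounded harmonic functions is finite-dimensional, then it consists of the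
constant functions. -/
lemma eq_of_mem_boundedHarmonic (hnonneg : ∀ x, 0 ≤ μ x) (hprob : HasSum μ 1)
    (hadapted : Subgroup.closure {x : G | μ x ≠ 0} = ⊤)
    [FiniteDimensional ℂ (boundedHarmonic hnonneg hprob.summable)] {f : G → ℂ}
    (hf : f ∈ boundedHarmonic hnonneg hprob.summable) (x y : G) : f x = f y := by
  obtain ⟨n, ⟨b⟩⟩ : ∃ n, Nonempty (Module.Basis (Fin n) ℂ
      (boundedHarmonic hnonneg hprob.summable)) := ⟨_, ⟨Module.finBasis ℂ _⟩⟩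
  have hinv : ∀ s, μ s ≠ 0 → ∀ y, f (y * s⁻¹) = f y := by
    intro s hs y
    obtain ⟨C, hC⟩ := hf.2
    obtain ⟨D, hD⟩ := exists_bound_repr b C
    rw [← sub_eq_zero, ← norm_le_zero_iff]
    refine le_of_forall_pos_le_add fun ε hε => ?_
    have hpos : 0 < n * |D| + 1 := by positivity
    obtain ⟨x, hx⟩ := exists_forall_norm_sub_lt hnonneg hprob (fun i => (b i).2) hs
      (div_pos hε hpos)
    set v : boundedHarmonic hnonneg hprob.summable :=
      ⟨_, translate_mem_boundedHarmonic hnonneg hprob.summable hf (y * x⁻¹)⟩ with hv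
    have hexp : ∀ z, f (y * x⁻¹ * z) = ∑ i, b.repr v i * (b i : G → ℂ) z := by
      intro z
      have h := congrFun (congrArg Subtype.val (b.sum_repr v)) z
      rw [Submodule.coe_sum, Finset.sum_apply] at h
      exact h.symm
    have h1 := hexp (x * s⁻¹)
    have h2 := hexp x
    rw [← mul_assoc, inv_mul_cancel_right] at h1
    rw [inv_mul_cancel_right] at h2
    rw [h1, h2, ← Finset.sum_sub_distrib, zero_add]
    calc _ ≤ ∑ i : Fin n, |D| * (ε / (n * |D| + 1)) := by
          refine norm_sum_le_of_le _ fun i _ => ?_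
          rw [← mul_sub, norm_mul]
          exact mul_le_mul ((hD v (fun z => hC _) i).trans (le_abs_self D)) (hx i).le
            (norm_nonneg _) (abs_nonneg D)
      _ = n * |D| * ε / (n * |D| + 1) := by
          rw [Finset.sum_const, Finset.card_univ, Fintype.card_fin, nsmul_eq_mul]; ring
      _ ≤ ε := by
          rw [div_le_iff₀ hpos]; nlinarith
  have hinv' : ∀ g : G, ∀ y, f (y * g⁻¹) = f y := by
    intro g
    have hg : g ∈ Subgroup.closure {x : G | μ x ≠ 0} := hadapted ▸ Subgroup.mem_top g
    induction hg using Subgroup.closure_induction with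
    | mem s hs => exact hinv s hs
    | one => simp
    | mul g h _ _ hg hh => intro y; rw [mul_inv_rev, ← mul_assoc, hg, hh]
    | inv g _ hg => intro y; rw [inv_inv, ← hg (y * g), mul_inv_cancel_right]
  simpa using (hinv' x x).symm.trans ((congrArg f (by simp)).trans (hinv' y y))

end Liouville

section Cesaro

variable {G : Type*} [Group G] {m : G → ℝ≥0∞}

/-- The adjoint of left convolution by `m`, acting on nonnegative functions. -/
noncomputable def leftStep (m a : G → ℝ≥0∞) (y : G) : ℝ≥0∞ := ∑' s, m s * a (s * y)

lemma tsum_leftStep (a : G → ℝ≥0∞) : ∑' y, leftStep m a y = (∑' s, m s) * ∑' y, a y := by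
  simp only [leftStep]
  rw [ENNReal.tsum_comm, ← ENNReal.tsum_mul_right]
  refine tsum_congr fun s => ?_
  rw [ENNReal.tsum_mul_left]
  exact congrArg _ ((Equiv.mulLeft s).tsum_eq a)

lemma leftStep_sum (F : Finset ℕ) (a : ℕ → G → ℝ≥0∞) (y : G) :
    leftStep m (fun y => ∑ n ∈ F, a n y) y = ∑ n ∈ F, leftStep m (a n) y := by
  simp only [leftStep, Finset.mul_sum]
  exact Summable.tsum_finsetSum fun _ _ => ENNReal.summable

lemma leftStep_const_mul (c : ℝ≥0∞) (a : G → ℝ≥0∞) (y : G) :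
    leftStep m (fun y => c * a y) y = c * leftStep m a y := by
  simp only [leftStep, mul_left_comm _ c, ENNReal.tsum_mul_left]

lemma tsum_iterate_leftStep (hm : ∑' s, m s = 1) {a : G → ℝ≥0∞} (ha : ∑' y, a y = 1) (n : ℕ) :
    ∑' y, (leftStep m)^[n] a y = 1 := by
  induction n with
  | zero => exact ha
  | succ n ih => rw [Function.iterate_succ_apply', tsum_leftStep, hm, ih, one_mul]

/-- Cesàro averages of the random walk are almost invariant under a further step. -/
lemma exists_almost_stationary (hm : ∑' s, m s = 1) (n : ℕ) :
    ∃ a : G → ℝ≥0∞, ∑' y, a y = 1 ∧ ∀ c : G → ℝ≥0∞, (∀ y, c y ≤ 1) →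
      ∑' y, leftStep m a y * c y ≤ ∑' y, a y * c y + (n + 1 : ℝ≥0∞)⁻¹ ∧
      ∑' y, a y * c y ≤ ∑' y, leftStep m a y * c y + (n + 1 : ℝ≥0∞)⁻¹ := by
  classical
  set d : G → ℝ≥0∞ := Pi.single 1 1 with hd
  have hd1 : ∑' y, d y = 1 := tsum_pi_single 1 1
  set N : ℝ≥0∞ := n + 1 with hN
  have hN0 : N ≠ 0 := by simp [hN]
  have hNt : N ≠ ⊤ := by simp [hN]
  set e : ℕ → G → ℝ≥0∞ := fun i => (leftStep m)^[i] d with he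
  have he1 : ∀ i, ∑' y, e i y = 1 := tsum_iterate_leftStep hm hd1
  set a : G → ℝ≥0∞ := fun y => N⁻¹ * ∑ i ∈ Finset.range (n + 1), e i y with ha
  have hstep : ∀ y, leftStep m a y + N⁻¹ * d y = a y + N⁻¹ * e (n + 1) y := by
    intro y
    rw [ha, leftStep_const_mul, leftStep_sum, ← mul_add, ← mul_add, ← Finset.sum_range_succ,
      Finset.sum_range_succ' _ (n + 1)]
    simp only [he, Function.iterate_succ_apply', Function.iterate_zero, id]
  refine ⟨a, ?_, fun c hc => ?_⟩
  · rw [ha, ENNReal.tsum_mul_left, Summable.tsum_finsetSum fun _ _ => ENNReal.summable]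
    simp only [he1, Finset.sum_const, Finset.card_range, nsmul_eq_mul, mul_one]
    push_cast
    exact ENNReal.inv_mul_cancel hN0 hNt
  · have hkey : ∑' y, leftStep m a y * c y + ∑' y, N⁻¹ * d y * c y =
        ∑' y, a y * c y + ∑' y, N⁻¹ * e (n + 1) y * c y := by
      rw [← ENNReal.tsum_add, ← ENNReal.tsum_add]
      exact tsum_congr fun y => by rw [← add_mul, ← add_mul, hstep]
    have hsmall : ∀ p : G → ℝ≥0∞, ∑' y, p y = 1 → ∑' y, N⁻¹ * p y * c y ≤ N⁻¹ := by
      intro p hp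
      calc _ ≤ ∑' y, N⁻¹ * p y := ENNReal.tsum_le_tsum fun y => mul_le_of_le_one_right' (hc y)
        _ = N⁻¹ := by rw [ENNReal.tsum_mul_left, hp, mul_one]
    constructor
    · exact le_self_add.trans (hkey.trans_le (by gcongr; exact hsmall _ (he1 _)))
    · exact le_self_add.trans (hkey.symm.trans_le (by gcongr; exact hsmall _ hd1))

/-- One step of the random walk from `x`, applied to a right matrix coefficient of `a`, amounts
to a step applied to `a`. -/
lemma tsum_mul_tsum_eq_leftStep (a b : G → ℝ≥0∞) (x : G) :
    ∑' s, m s * ∑' y, a y * b (x * s⁻¹ * y) = ∑' y, leftStep m a y * b (x * y) := by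
  simp only [leftStep, ← ENNReal.tsum_mul_right, ← ENNReal.tsum_mul_left]
  rw [ENNReal.tsum_comm (f := fun y s => m s * a (s * y) * b (x * y))]
  refine tsum_congr fun s => ?_
  rw [← (Equiv.mulLeft s).tsum_eq]
  exact tsum_congr fun y => by simp [mul_assoc]

end Cesaro

/-- Ultralimits of uniformly bounded, asymptotically harmonic functions are harmonic. -/
lemma exists_harmonic_ultralimit {G : Type*} [Group G] {μ : G → ℝ} (hnonneg : ∀ x, 0 ≤ μ x)
    (hμ : Summable μ) (U : Ultrafilter ℕ) {v : ℕ → G → ℝ} (hv0 : ∀ n x, 0 ≤ v n x)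
    (hv1 : ∀ n x, v n x ≤ 1)
    (hlim : ∀ x, Filter.Tendsto (fun n => (∑' s, μ s * v n (x * s⁻¹)) - v n x) U (nhds 0)) :
    ∃ u : G → ℝ, (∀ x, |u x| ≤ 1) ∧ IsHarmonic μ (fun x => (u x : ℂ)) ∧
      ∀ x, Filter.Tendsto (fun n => v n x) U (nhds (u x)) := by
  have hex : ∀ x, ∃ l ∈ Set.Icc (0 : ℝ) 1, Filter.Tendsto (fun n => v n x) U (nhds l) :=
    fun x => isCompact_Icc.ultrafilter_le_nhds' (U.map fun n => v n x)
      (Filter.Eventually.of_forall (f := (U : Filter ℕ)) fun n => ⟨hv0 n x, hv1 n x⟩)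
  choose u hu hlimu using hex
  refine ⟨u, fun x => abs_le.2 ⟨by linarith [(hu x).1], (hu x).2⟩, fun x => ?_, hlimu⟩
  have h1 : Filter.Tendsto (fun n => ∑' s, μ s * v n (x * s⁻¹)) U
      (nhds (∑' s, μ s * u (x * s⁻¹))) := by
    refine tendsto_tsum_of_dominated_convergence hμ (fun s => (hlimu _).const_mul _)
      (Filter.Eventually.of_forall fun n s => ?_)
    rw [Real.norm_of_nonneg (mul_nonneg (hnonneg s) (hv0 _ _))]
    exact mul_le_of_le_one_right (hnonneg s) (hv1 _ _)
  have h2 := tendsto_nhds_unique (hlim x) (h1.sub (hlimu x))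
  have h3 : u x = ∑' s, μ s * u (x * s⁻¹) := by linarith
  simp only
  rw [h3, Complex.ofReal_tsum]
  push_cast
  rfl

section Folner

variable {G : Type*} [Group G] [DecidableEq G]

/-- An almost invariant probability measure has a Følner superlevel set. -/
lemma exists_folner_of_almost_invariant [Countable G] (K : Finset G) {ε : ℝ} (hε : 0 < ε)
    {r : G → ℝ} (hr0 : ∀ x, 0 ≤ r x) (hr : ∑' x, ENNReal.ofReal (r x) = 1)
    (hK : ∑ g ∈ K, ∑' x, ENNReal.ofReal (r (g⁻¹ * x) - r x) < ENNReal.ofReal ε) :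
    ∃ F : Finset G, F.Nonempty ∧ ((K * F).card : ℝ) ≤ (1 + ε) * F.card := by
  by_contra! hcon
  have hfin : ∀ t : ℝ, 0 < t → {x | t < r x}.Finite := by
    intro t ht
    have hs : Summable r := by
      have := ENNReal.summable_toReal (f := fun x => ENNReal.ofReal (r x)) (by simp [hr])
      simpa [hr0] using this
    have := hs.tendsto_cofinite_zero.eventually (gt_mem_nhds ht)
    refine (Filter.eventually_cofinite.1 this).subset fun x (hx : t < r x) => not_lt.2 hx.le
  have hle : ∀ t ∈ Set.Ioi (0 : ℝ),
      ENNReal.ofReal ε * ∑' x, (Set.Ico 0 (r x)).indicator 1 t ≤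
      ∑ g ∈ K, ∑' x, (Set.Ico (r x) (r (g⁻¹ * x))).indicator (1 : ℝ → ℝ≥0∞) t := by
    intro t ht
    have ht : 0 < t := ht
    set F := (hfin t ht).toFinset with hF
    have hmem : ∀ x, x ∈ F ↔ t < r x := fun x => by simp [hF]
    have h1 : ∑' x, (Set.Ico 0 (r x)).indicator (1 : ℝ → ℝ≥0∞) t = F.card := by
      rw [tsum_eq_sum (s := F)]
      · rw [Finset.card_eq_sum_ones, Nat.cast_sum]
        exact Finset.sum_congr rfl fun x hx => by
          rw [Set.indicator_of_mem (show t ∈ Set.Ico 0 (r x) from ⟨ht.le, (hmem x).1 hx⟩)]; simp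
      · exact fun x hx => Set.indicator_of_notMem (fun h => hx ((hmem x).2 h.2)) _
    have h2 : ∀ g, ∑' x, (Set.Ico (r x) (r (g⁻¹ * x))).indicator (1 : ℝ → ℝ≥0∞) t =
        ((F.image (g * ·)) \ F).card := by
      intro g
      have hmem' : ∀ x, x ∈ F.image (g * ·) \ F ↔ t ∈ Set.Ico (r x) (r (g⁻¹ * x)) := by
        intro x
        rw [Finset.mem_sdiff, hmem, not_lt, Finset.mem_image, and_comm, Set.mem_Ico]
        refine and_congr_right fun _ => ⟨?_, fun h => ⟨g⁻¹ * x, (hmem _).2 h, by simp⟩⟩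
        rintro ⟨y, hy, rfl⟩
        simpa using (hmem y).1 hy
      rw [tsum_eq_sum (s := F.image (g * ·) \ F)]
      · rw [Finset.card_eq_sum_ones, Nat.cast_sum]
        exact Finset.sum_congr rfl fun x hx => by
          rw [Set.indicator_of_mem ((hmem' x).1 hx)]; simp
      · exact fun x hx => Set.indicator_of_notMem (fun h => hx ((hmem' x).2 h)) _
    simp only [h1, h2]
    rcases F.eq_empty_or_nonempty with hFe | hFn
    · simp [hFe]
    have hcard : (K * F).card ≤ F.card + ∑ g ∈ K, (F.image (g * ·) \ F).card := by
      have hsub : K * F ⊆ F ∪ K.biUnion fun g => F.image (g * ·) \ F := by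
        intro x hx
        obtain ⟨g, hg, y, hy, rfl⟩ := Finset.mem_mul.1 hx
        by_cases h : g * y ∈ F
        · exact Finset.mem_union_left _ h
        · exact Finset.mem_union_right _ (Finset.mem_biUnion.2
            ⟨g, hg, Finset.mem_sdiff.2 ⟨Finset.mem_image_of_mem _ hy, h⟩⟩)
      exact (Finset.card_le_card hsub).trans ((Finset.card_union_le _ _).trans
        (Nat.add_le_add_left Finset.card_biUnion_le _))
    have hlt := hcon F hFn
    have hcard' : ((K * F).card : ℝ) ≤
        F.card + ((∑ g ∈ K, (F.image (g * ·) \ F).card : ℕ) : ℝ) := by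
      exact_mod_cast hcard
    rw [← Nat.cast_sum, ← ENNReal.ofReal_natCast, ← ENNReal.ofReal_natCast,
      ← ENNReal.ofReal_mul hε.le]
    exact ENNReal.ofReal_le_ofReal (by linarith)
  have hmeas : ∀ p q : ℝ, Measurable ((Set.Ico p q).indicator (1 : ℝ → ℝ≥0∞)) := fun p q =>
    measurable_one.indicator measurableSet_Ico
  have hint : ∀ p q : ℝ, 0 ≤ p →
      ∫⁻ t in Set.Ioi (0 : ℝ), (Set.Ico p q).indicator (1 : ℝ → ℝ≥0∞) t =
        ENNReal.ofReal (q - p) := by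
    intro p q hp
    rw [MeasureTheory.setLIntegral_congr MeasureTheory.Ioi_ae_eq_Ici,
      MeasureTheory.lintegral_indicator_one measurableSet_Ico,
      MeasureTheory.Measure.restrict_apply measurableSet_Ico,
      Set.inter_eq_left.2 (Set.Ico_subset_Ici_self.trans (Set.Ici_subset_Ici.2 hp)),
      Real.volume_Ico]
  have hlast := MeasureTheory.setLIntegral_mono'
    (μ := MeasureTheory.volume) measurableSet_Ioi hle
  rw [MeasureTheory.lintegral_const_mul _ (Measurable.tsum fun x => hmeas _ _),
    MeasureTheory.lintegral_tsum fun x => (hmeas _ _).aemeasurable,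
    MeasureTheory.lintegral_finsetSum _ fun g _ => Measurable.tsum fun x => hmeas _ _]
    at hlast
  simp only [MeasureTheory.lintegral_tsum fun x => (hmeas _ _).aemeasurable, hint _ _ le_rfl,
    hint _ _ (hr0 _), sub_zero, hr, mul_one] at hlast
  exact absurd hK (not_lt.2 hlast)

end Folner

/-- A group generated by a finite set is countable. -/
lemma countable_of_closure_eq_top {G : Type*} [Group G] (S : Finset G)
    (hS : Subgroup.closure (S : Set G) = ⊤) : Countable G := by
  have hsurj : Function.Surjective (FreeGroup.lift ((↑) : S → G)) := by
    rw [← MonoidHom.range_eq_top, FreeGroup.range_lift_eq_closure, Subtype.range_coe]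
    exact hS
  have : Countable (FreeGroup S) := Quot.mk_surjective.countable
  exact hsurj.countable

/-- If bounded harmonic functions are constant, then Cesàro averages of the random walk are
asymptotically invariant under left translation, along any ultrafilter. -/
lemma tendsto_displacement {G : Type*} [Group G] {μ : G → ℝ} (hnonneg : ∀ x, 0 ≤ μ x)
    (hprob : HasSum μ 1)
    (hconst : ∀ f ∈ boundedHarmonic hnonneg hprob.summable, ∀ x y, f x = f y)
    {a : ℕ → G → ℝ≥0∞} (ha : ∀ n, ∑' y, a n y = 1)
    (hstat : ∀ n, ∀ c : G → ℝ≥0∞, (∀ y, c y ≤ 1) →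
      ∑' y, leftStep (fun s => ENNReal.ofReal (μ s)) (a n) y * c y ≤
        ∑' y, a n y * c y + (n + 1 : ℝ≥0∞)⁻¹ ∧
      ∑' y, a n y * c y ≤
        ∑' y, leftStep (fun s => ENNReal.ofReal (μ s)) (a n) y * c y + (n + 1 : ℝ≥0∞)⁻¹)
    (U : Ultrafilter ℕ) (hU : (U : Filter ℕ) ≤ Filter.atTop) (g : G) :
    Filter.Tendsto (fun n => ∑' y, (a n (g⁻¹ * y) - a n y)) U (nhds 0) := by
  classical
  set b : ℕ → G → ℝ≥0∞ := fun n y => if a n y < a n (g⁻¹ * y) then 1 else 0 with hb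
  have hb1 : ∀ n y, b n y ≤ 1 := fun n y => by simp only [hb]; split_ifs <;> simp
  set w : ℕ → G → ℝ≥0∞ := fun n x => ∑' y, a n y * b n (x * y) with hw
  have hw1 : ∀ n x, w n x ≤ 1 := fun n x =>
    (ENNReal.tsum_le_tsum fun y => mul_le_of_le_one_right' (hb1 n _)).trans_eq (ha n)
  have hwtop : ∀ n x, w n x ≠ ⊤ := fun n x => ((hw1 n x).trans_lt ENNReal.one_lt_top).ne
  have hinv : ∀ n : ℕ, ((n + 1 : ℝ≥0∞)⁻¹).toReal = 1 / ((n : ℝ) + 1) := fun n => by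
    rw [ENNReal.toReal_inv, ENNReal.toReal_add (by simp) (by simp)]; simp
  have hinvtop : ∀ n : ℕ, (n + 1 : ℝ≥0∞)⁻¹ ≠ ⊤ := fun n => by simp
  have hstep : ∀ n x, |(∑' s, μ s * (w n (x * s⁻¹)).toReal) - (w n x).toReal| ≤
      1 / ((n : ℝ) + 1) := by
    intro n x
    set p : ℝ≥0∞ := ∑' s, ENNReal.ofReal (μ s) * w n (x * s⁻¹) with hp
    have hp1 : (∑' s, μ s * (w n (x * s⁻¹)).toReal) = p.toReal := by
      rw [hp, ENNReal.tsum_toReal_eq fun s => ENNReal.mul_ne_top ENNReal.ofReal_ne_top (hwtop _ _)]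
      exact tsum_congr fun s => by rw [ENNReal.toReal_mul, ENNReal.toReal_ofReal (hnonneg s)]
    have hp2 : p = ∑' y, leftStep (fun s => ENNReal.ofReal (μ s)) (a n) y * b n (x * y) :=
      tsum_mul_tsum_eq_leftStep _ _ _
    obtain ⟨h1, h2⟩ := hstat n (fun y => b n (x * y)) fun y => hb1 n _
    rw [← hp2] at h1 h2
    have hptop : p ≠ ⊤ := ne_top_of_le_ne_top (ENNReal.add_ne_top.2 ⟨hwtop n x, hinvtop n⟩) h1
    have h1' := ENNReal.toReal_mono (ENNReal.add_ne_top.2 ⟨hwtop n x, hinvtop n⟩) h1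
    have h2' := ENNReal.toReal_mono (ENNReal.add_ne_top.2 ⟨hptop, hinvtop n⟩) h2
    rw [ENNReal.toReal_add (hwtop n x) (hinvtop n), hinv] at h1'
    rw [ENNReal.toReal_add hptop (hinvtop n), hinv] at h2'
    rw [hp1, abs_le]
    constructor <;> linarith
  obtain ⟨u, hu1, huharm, hulim⟩ := exists_harmonic_ultralimit hnonneg hprob.summable U
    (v := fun n x => (w n x).toReal) (fun n x => ENNReal.toReal_nonneg)
    (fun n x => ENNReal.toReal_le_of_le_ofReal zero_le_one (by simpa using hw1 n x))
    (fun x => squeeze_zero_norm (fun n => hstep n x)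
      (tendsto_one_div_add_atTop_nhds_zero_nat.mono_left hU))
  have hueq : u g = u 1 := by
    have := hconst (fun x => (u x : ℂ)) ⟨huharm, 1, fun x => by simpa using hu1 x⟩ g 1
    exact_mod_cast this
  have hdisp : ∀ n, w n g = w n 1 + ∑' y, (a n (g⁻¹ * y) - a n y) := by
    intro n
    simp only [hw, one_mul]
    rw [← (Equiv.mulLeft g⁻¹).tsum_eq, ← ENNReal.tsum_add]
    refine tsum_congr fun y => ?_
    simp only [Equiv.coe_mulLeft, mul_inv_cancel_left, hb]
    split_ifs with h
    · rw [mul_one, mul_one, add_tsub_cancel_of_le h.le]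
    · simp [tsub_eq_zero_of_le (not_lt.1 h)]
  have hdisp' : ∀ n, ∑' y, (a n (g⁻¹ * y) - a n y) =
      ENNReal.ofReal ((w n g).toReal - (w n 1).toReal) := by
    intro n
    have htop : ∑' y, (a n (g⁻¹ * y) - a n y) ≠ ⊤ :=
      ne_top_of_le_ne_top (hwtop n g) (by rw [hdisp n]; exact le_add_self)
    rw [hdisp n, ENNReal.toReal_add (hwtop n 1) htop, add_sub_cancel_left,
      ENNReal.ofReal_toReal htop]
  simp only [hdisp']
  have := ENNReal.tendsto_ofReal ((hulim g).sub (hulim 1))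
  rwa [hueq, sub_self, ENNReal.ofReal_zero] at this

theorem finite_dim_HFk_implies_amenable
    {G : Type*} [Group G] [DecidableEq G]
    (S : Finset G) (hSgen : Subgroup.closure (S : Set G) = ⊤)
    (hSsym : ∀ s ∈ S, s⁻¹ ∈ S)
    (μ : G → ℝ) (hnonneg : ∀ x, 0 ≤ μ x) (hprob : HasSum μ 1)
    (hsym : ∀ x : G, μ x⁻¹ = μ x)
    (hadapted : Subgroup.closure {x : G | μ x ≠ 0} = ⊤)
    (hsmooth : ∃ ζ : ℝ, 0 < ζ ∧
      Summable (fun x : G => μ x * Real.exp (ζ * (wordLen (S : Set G) x))))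
    (k : ℕ)
    (hfin : ∃ W : Submodule ℂ (G → ℂ), FiniteDimensional ℂ W ∧
      HFk (S : Set G) μ k ⊆ (W : Set (G → ℂ))) :
    ∀ K : Finset G, ∀ ε : ℝ, 0 < ε →
      ∃ F : Finset G, F.Nonempty ∧ ((K * F).card : ℝ) ≤ (1 + ε) * F.card := by
  intro K ε hε
  have := countable_of_closure_eq_top S hSgen
  obtain ⟨W, hW, hsub⟩ := hfin
  have hle : boundedHarmonic hnonneg hprob.summable ≤ W := by
    rintro f ⟨hf, C, hC⟩
    exact hsub (mem_HFk_of_bounded _ k hf hC)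
  have : FiniteDimensional ℂ (boundedHarmonic hnonneg hprob.summable) :=
    Submodule.finiteDimensional_of_le hle
  have hm : ∑' s, ENNReal.ofReal (μ s) = 1 := by
    rw [← ENNReal.ofReal_tsum_of_nonneg hnonneg hprob.summable, hprob.tsum_eq, ENNReal.ofReal_one]
  choose a ha hstat using exists_almost_stationary hm
  have hlim := tendsto_finsetSum K fun g _ => tendsto_displacement hnonneg hprob
    (fun f hf => eq_of_mem_boundedHarmonic hnonneg hprob hadapted hf) ha hstat
    (Filter.hyperfilter ℕ) Nat.hyperfilter_le_atTop g
  rw [Finset.sum_const_zero] at hlim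
  obtain ⟨n, hn⟩ := (hlim.eventually (gt_mem_nhds (ENNReal.ofReal_pos.2 hε))).exists
  have htop : ∀ x, a n x ≠ ⊤ := fun x =>
    ne_top_of_le_ne_top ENNReal.one_ne_top ((ENNReal.le_tsum x).trans_eq (ha n))
  refine exists_folner_of_almost_invariant K hε (r := fun x => (a n x).toReal)
    (fun x => ENNReal.toReal_nonneg) ?_ ?_
  · simpa only [ENNReal.ofReal_toReal (htop _)] using ha n
  · simpa only [ENNReal.ofReal_sub _ ENNReal.toReal_nonneg, ENNReal.ofReal_toReal (htop _)]
      using hn
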